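/- Let G be a connected graph and u, v vertices with d(u,v) ≥ 3. Define N^k(u,v) = {x : min(d(u,x), d(v,x)) = k}, and define the sets A_k, B_k recursively by A_1 = N^1(u,v), B_1 = ∅, B_k = N^k(u,v) ∩ (N(B_{k−1}) ∪ N({x ∈ A_{k−1} : N(x) ∩ N^{k−1}(u,v) ≠ ∅}) ∪ {x ∈ N^k(u,v) : |N(x) ∩ A_{k−1}| ≥ 2}), A_k = N^k(u,v) \ B_k. Then every x ∈ A_k with N(x) ∩ N^k(u,v) = ∅ satisfies |d(x,u) − d(x,v)| ≥ 2, i.e., x is a witness of the non-edge {u,v}. -/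

import Mathlib

/-- `sphere G u v k` is the set `N^k(u,v)` of vertices at distance exactly `k`
from the pair `{u,v}`, i.e. with `min(d(u,x), d(v,x)) = k`. -/
def sphere {V : Type*} (G : SimpleGraph V) (u v : V) (k : ℕ) : Set V :=
  {x | min (G.dist u x) (G.dist v x) = k}

/-- `nbhd G X` is the set of vertices adjacent to some vertex of `X`. -/
def nbhd {V : Type*} (G : SimpleGraph V) (X : Set V) : Set V :=
  {y | ∃ x ∈ X, G.Adj x y}

/-- The recursive partition `(A_k, B_k)` of `N^k(u,v)`:
`A₁ = N¹(u,v)`, `B₁ = ∅`, and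
`B_k = N^k(u,v) ∩ (N(B_{k−1}) ∪ N({x ∈ A_{k−1} : N(x) ∩ N^{k−1}(u,v) ≠ ∅})
  ∪ {x ∈ N^k(u,v) : |N(x) ∩ A_{k−1}| ≥ 2})`, `A_k = N^k(u,v) \ B_k`. -/
noncomputable def AB {V : Type*} (G : SimpleGraph V) (u v : V) : ℕ → Set V × Set V
  | 0 => (∅, ∅)
  | 1 => (sphere G u v 1, ∅)
  | (k + 2) =>
    let A := (AB G u v (k + 1)).1
    let B := (AB G u v (k + 1)).2
    let Bk := sphere G u v (k + 2) ∩
      (nbhd G B ∪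
        nbhd G {x ∈ A | (nbhd G {x} ∩ sphere G u v (k + 1)).Nonempty} ∪
        {x ∈ sphere G u v (k + 2) | 2 ≤ ({y | G.Adj x y} ∩ A).ncard})
    (sphere G u v (k + 2) \ Bk, Bk)

namespace SimpleGraph

variable {V : Type*} {G : SimpleGraph V}

theorem Connected.dist_le_dist_add_one_of_adj (hG : G.Connected) {x y : V} (h : G.Adj x y)
    (a : V) : G.dist a x ≤ G.dist a y + 1 := by
  have := hG.dist_triangle (u := a) (v := y) (w := x)
  rwa [dist_eq_one_iff_adj.mpr h.symm] at this

theorem Connected.exists_adj_dist_eq (hG : G.Connected) {a x : V} {n : ℕ}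
    (h : G.dist a x = n + 1) : ∃ y, G.Adj x y ∧ G.dist a y = n := by
  obtain ⟨p, hp⟩ := hG.exists_walk_length_eq_dist x a
  rw [dist_comm, h] at hp
  cases p with
  | nil => simp at hp
  | @cons _ y _ hxy q =>
    refine ⟨y, hxy, ?_⟩
    have h₁ := dist_le q
    have h₂ := hG.dist_le_dist_add_one_of_adj hxy a
    rw [Walk.length_cons] at hp
    rw [dist_comm] at h₁
    omega

end SimpleGraph

theorem sphere_comm {V : Type*} (G : SimpleGraph V) (u v : V) (k : ℕ) :
    sphere G u v k = sphere G v u k := by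
  simp only [sphere, min_comm]

theorem AB_comm {V : Type*} (G : SimpleGraph V) (u v : V) (k : ℕ) :
    AB G u v k = AB G v u k := by
  induction k using Nat.twoStepInduction with
  | zero => rfl
  | one => simp only [AB, sphere_comm G u v]
  | more k _ ih => simp only [AB, sphere_comm G u v, ih]

theorem AB_fst_subset_sphere {V : Type*} (G : SimpleGraph V) (u v : V) (k : ℕ) :
    (AB G u v k).1 ⊆ sphere G u v k := by
  match k with
  | 0 => exact Set.empty_subset _
  | 1 => exact subset_rfl
  | k + 2 => exact Set.sdiff_subset

theorem mem_AB_fst_or_snd {V : Type*} {G : SimpleGraph V} {u v x : V} {k : ℕ}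
    (hx : x ∈ sphere G u v (k + 1)) : x ∈ (AB G u v (k + 1)).1 ∨ x ∈ (AB G u v (k + 1)).2 := by
  match k with
  | 0 => exact .inl hx
  | k + 1 =>
    by_cases h : x ∈ (AB G u v (k + 2)).2
    · exact .inr h
    · exact .inl ⟨hx, h⟩

/-- All neighbours of `x ∈ A_{k+2}` in the previous layer lie in `A_{k+1}` and have no neighbour
in their own layer. -/
theorem mem_AB_fst_of_adj {V : Type*} {G : SimpleGraph V} {u v x y : V} {k : ℕ}
    (hx : x ∈ (AB G u v (k + 2)).1) (hxy : G.Adj x y) (hy : y ∈ sphere G u v (k + 1)) :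
    y ∈ (AB G u v (k + 1)).1 ∧ nbhd G {y} ∩ sphere G u v (k + 1) = ∅ := by
  obtain ⟨hxs, hxB⟩ := hx
  have hyA : y ∈ (AB G u v (k + 1)).1 := (mem_AB_fst_or_snd hy).resolve_right fun hyB ↦
    hxB ⟨hxs, .inl (.inl ⟨y, hyB, hxy.symm⟩)⟩
  refine ⟨hyA, Set.not_nonempty_iff_eq_empty.mp fun hne ↦ ?_⟩
  exact hxB ⟨hxs, .inl (.inr ⟨y, ⟨hyA, hne⟩, hxy.symm⟩)⟩

/-- A vertex of `A_{k+2}` has at most one neighbour in the previous layer. -/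
theorem eq_of_adj_of_mem_AB_fst {V : Type*} [Finite V] {G : SimpleGraph V} {u v x y z : V} {k : ℕ}
    (hx : x ∈ (AB G u v (k + 2)).1) (hxy : G.Adj x y) (hy : y ∈ sphere G u v (k + 1))
    (hxz : G.Adj x z) (hz : z ∈ sphere G u v (k + 1)) : y = z := by
  have hyA := (mem_AB_fst_of_adj hx hxy hy).1
  have hzA := (mem_AB_fst_of_adj hx hxz hz).1
  obtain ⟨hxs, hxB⟩ := hx
  by_contra hne
  refine hxB ⟨hxs, .inr ⟨hxs, ?_⟩⟩
  exact (Set.one_lt_ncard (Set.toFinite _)).mpr ⟨y, ⟨hxy, hyA⟩, z, ⟨hxz, hzA⟩, hne⟩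

theorem add_two_le_dist_of_mem_AB_fst {V : Type*} [Finite V] {G : SimpleGraph V}
    (hG : G.Connected) {u v : V} (huv : 3 ≤ G.dist u v) {k : ℕ} {x : V}
    (hx : x ∈ (AB G u v (k + 1)).1) (hnx : nbhd G {x} ∩ sphere G u v (k + 1) = ∅)
    (hux : G.dist u x = k + 1) : k + 3 ≤ G.dist v x := by
  induction k generalizing x with
  | zero =>
    have huvx := hG.dist_triangle (u := u) (v := x) (w := v)
    rw [G.dist_comm (u := x)] at huvx
    by_contra hlt
    obtain ⟨z, hxz, hvz⟩ := hG.exists_adj_dist_eq (a := v) (x := x) (n := 1) (by omega)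
    have huvz := hG.dist_triangle (u := u) (v := z) (w := v)
    rw [G.dist_comm (u := z)] at huvz
    have hz : z ∈ sphere G u v 1 := show min _ _ = _ by omega
    exact (hnx ▸ ⟨⟨x, rfl, hxz⟩, hz⟩ : z ∈ (∅ : Set V))
  | succ k ih =>
    have hxs : min (G.dist u x) (G.dist v x) = k + 2 := AB_fst_subset_sphere G u v _ hx
    obtain ⟨y, hxy, huy⟩ := hG.exists_adj_dist_eq hux
    have hvxy := hG.dist_le_dist_add_one_of_adj hxy v
    have hy : y ∈ sphere G u v (k + 1) := show min _ _ = _ by omega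
    obtain ⟨hyA, hny⟩ := mem_AB_fst_of_adj hx hxy hy
    have hvy := ih hyA hny huy
    by_contra hlt
    obtain ⟨z, hxz, hvz⟩ := hG.exists_adj_dist_eq (a := v) (x := x) (n := G.dist v x - 1) (by omega)
    have huxz := hG.dist_le_dist_add_one_of_adj hxz u
    have hz : z ∈ sphere G u v (k + 1) ∨ z ∈ sphere G u v (k + 2) := by
      change min _ _ = _ ∨ min _ _ = _
      omega
    obtain hz | hz := hz
    · obtain rfl := eq_of_adj_of_mem_AB_fst hx hxy hy hxz hz
      omega
    · exact (hnx ▸ ⟨⟨x, rfl, hxz⟩, hz⟩ : z ∈ (∅ : Set V))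

/-- Every `x ∈ A_k` with no neighbour in `N^k(u,v)` is a witness of the non-edge `{u,v}`. -/
theorem Ak_are_witnesses {V : Type*} [Fintype V] (G : SimpleGraph V) (hG : G.Connected)
    (u v : V) (huv : 3 ≤ G.dist u v) (k : ℕ) (hk : 1 ≤ k) (x : V)
    (hx : x ∈ (AB G u v k).1) (hnx : nbhd G {x} ∩ sphere G u v k = ∅) :
    2 ≤ |(G.dist u x : ℤ) - (G.dist v x : ℤ)| := by
  obtain ⟨k, rfl⟩ := Nat.exists_eq_add_of_le' hk
  have hxs : min (G.dist u x) (G.dist v x) = k + 1 := AB_fst_subset_sphere G u v _ hx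
  rw [le_abs]
  obtain hux | hvx : G.dist u x = k + 1 ∨ G.dist v x = k + 1 := by omega
  · have := add_two_le_dist_of_mem_AB_fst hG huv hx hnx hux
    omega
  · rw [SimpleGraph.dist_comm] at huv
    rw [AB_comm] at hx
    rw [sphere_comm] at hnx
    have := add_two_le_dist_of_mem_AB_fst hG huv hx hnx hvx
    omega
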